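/- Let ω ∉ {ε, ab, ba, aba} be a factor of F_∞ with sk(ω) = s_k and unique kernel decomposition ω = μ₁ s_k μ₂. Then for every p ≥ 1: (1) the p-th occurrence ω_p of ω decomposes as ω_p = μ₁ · s_{k,p} · μ₂, where s_{k,p} is the p-th occurrence of s_k in F_∞ (i.e., the copy of s_k inside ω_p is the p-th occurrence of s_k); (2) in the free group on {a,b}, the gap satisfies ν_{ω,p} = μ₂^{-1} · ν_{s_k,p} · μ₁^{-1}. -/

import Mathlib

/-- Finite Fibonacci words: `Fw k = σ^k(a)` where `a = false`, `b = true`,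
`σ(a) = ab`, `σ(b) = a`; so `Fw (k+2) = Fw (k+1) ++ Fw k`. -/
def Fw : ℕ → List Bool
  | 0 => [false]
  | 1 => [false, true]
  | (k+2) => Fw (k+1) ++ Fw k

/-- The infinite Fibonacci word `F_∞` (0-indexed): since `Fw (n+1)` has length
`fib (n+3) > n`, its `n`-th letter is the `n`-th letter of `F_∞`. -/
def fw (n : ℕ) : Bool := (Fw (n+1)).getD n false

/-- Singular words, with index shifted by one: `sw n = s_{n-1}`.
`sw 0 = s_{-1} = a`, and `sw (n+1) = s_n = β_n · F_n · α_n⁻¹` where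
`α_n` is the last letter of `F_n` and `β_n` the other letter. -/
def sw : ℕ → List Bool
  | 0 => [false]
  | (n+1) => (!((Fw n).getLastD false)) :: (Fw n).dropLast

/-- The factor of `F_∞` of length `n` starting at (0-indexed) position `i`. -/
def seg (i n : ℕ) : List Bool := (List.range n).map (fun t => fw (i + t))

/-- `w` occurs in `F_∞` at (0-indexed) position `i`. -/
def OccursAt (w : List Bool) (i : ℕ) : Prop := seg i w.length = w

/-- `w` is a factor of `F_∞`. -/
def IsFactor (w : List Bool) : Prop := ∃ i, OccursAt w i

/-- Starting position of the `(p+1)`-st occurrence of `w` in `F_∞`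
(occurrences enumerated by starting position, 0-indexed: `occPos w 0`
is the first occurrence, i.e. the paper's `ω_1`). -/
noncomputable def occPos (w : List Bool) (p : ℕ) : ℕ := Nat.nth (OccursAt w) p

/-- A finite word viewed as an element of the free group on the alphabet. -/
def listToFree (w : List Bool) : FreeGroup Bool := (w.map FreeGroup.of).prod

/-- The gap `ν_{w,p}` (0-indexed in `p`: `gap w 0` is the paper's `ν_{w,1}`)
between the `(p+1)`-st and `(p+2)`-nd occurrences of `w`, as an element of the
free group: the separating word if the occurrences are separated or adjacent,
and the formal inverse of the overlap if they overlap. -/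
noncomputable def gap (w : List Bool) (p : ℕ) : FreeGroup Bool :=
  if occPos w p + w.length ≤ occPos w (p+1) then
    listToFree (seg (occPos w p + w.length) (occPos w (p+1) - (occPos w p + w.length)))
  else
    (listToFree (seg (occPos w (p+1)) (occPos w p + w.length - occPos w (p+1))))⁻¹

/-- The signed length `|ν_{w,p}|` of the gap (negative in the overlapped case). -/
noncomputable def gapLen (w : List Bool) (p : ℕ) : ℤ :=
  (occPos w (p+1) : ℤ) - ((occPos w p : ℤ) + (w.length : ℤ))

/-- `u` is a singular word (some `s_k`, `k ≥ -1`). -/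
def IsSingular (u : List Bool) : Prop := ∃ n, u = sw n

/-- `u` is a singular kernel of `w`: a singular factor of `w` of maximal length. -/
def IsKernelOf (u w : List Bool) : Prop :=
  IsSingular u ∧ u <:+: w ∧ ∀ v : List Bool, IsSingular v → v <:+: w → v.length ≤ u.length

/-- The excluded words `{ε, ab, ba, aba}`. -/
def excl : List (List Bool) := [[], [false, true], [true, false], [false, true, false]]

/-- The `i`-th conjugate `C_i(w)` (indices taken mod the length). -/
def conj (i : ℕ) (w : List Bool) : List Bool :=
  w.drop (i % w.length) ++ w.take (i % w.length)

/-- `sliceW u i j = u[i,j]`, the letters `i` through `j` of `u`, 1-indexed. -/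
def sliceW (u : List Bool) (i j : ℕ) : List Bool := (u.take j).drop (i - 1)

/-- The Fibonacci morphism `a ↦ ab`, `b ↦ a`, on finite words. -/
def fibMorph : List Bool → List Bool
  | [] => []
  | false :: w => false :: true :: fibMorph w
  | true :: w => false :: fibMorph w

theorem fibMorph_append (u v : List Bool) : fibMorph (u ++ v) = fibMorph u ++ fibMorph v := by
  induction u with
  | nil => rfl
  | cons x u ih => cases x <;> simp [fibMorph, ih]

theorem fibMorph_Fw (n : ℕ) : fibMorph (Fw n) = Fw (n + 1) := by
  induction n using Nat.twoStepInduction with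
  | zero => rfl
  | one => rfl
  | more n h₀ h₁ =>
    rw [show Fw (n + 2) = Fw (n + 1) ++ Fw n from rfl, fibMorph_append, h₀, h₁]
    rfl

/-- Reversal conjugates the morphism by the letter `a`. -/
theorem cons_reverse_fibMorph (w : List Bool) :
    false :: (fibMorph w).reverse = fibMorph w.reverse ++ [false] := by
  induction w with
  | nil => rfl
  | cons x w ih =>
    cases x <;> simp [fibMorph, fibMorph_append, ← List.cons_append, ih]

theorem exists_fibMorph_append_eq_cons (w : List Bool) :
    ∃ v, fibMorph w ++ [false] = false :: v := by
  rcases w with _ | ⟨_ | _, w⟩ <;> simp [fibMorph]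

theorem lt_length_Fw (n : ℕ) : n < (Fw n).length := by
  induction n using Nat.twoStepInduction with
  | zero => simp [Fw]
  | one => simp [Fw]
  | more n h₀ h₁ =>
    rw [show Fw (n + 2) = Fw (n + 1) ++ Fw n from rfl, List.length_append]
    omega

theorem Fw_prefix_succ (n : ℕ) : Fw n <+: Fw (n + 1) := by
  cases n with
  | zero => exact ⟨[true], rfl⟩
  | succ n => exact ⟨Fw n, rfl⟩

theorem Fw_prefix_of_le {m n : ℕ} (h : m ≤ n) : Fw m <+: Fw n := by
  induction n, h using Nat.le_induction with
  | base => exact List.prefix_rfl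
  | succ n _ ih => exact ih.trans (Fw_prefix_succ n)

theorem length_seg (i n : ℕ) : (seg i n).length = n := by simp [seg]

theorem seg_add (i m n : ℕ) : seg i (m + n) = seg i m ++ seg (i + m) n := by
  simp [seg, List.range_add, Function.comp_def, add_assoc]

theorem occursAt_nil (i : ℕ) : OccursAt [] i := rfl

theorem occursAt_append (u v : List Bool) (i : ℕ) :
    OccursAt (u ++ v) i ↔ OccursAt u i ∧ OccursAt v (i + u.length) := by
  unfold OccursAt
  rw [List.length_append, seg_add]
  exact ⟨fun h => List.append_inj h (length_seg _ _), fun h => by rw [h.1, h.2]⟩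

theorem occursAt_singleton (x : Bool) (i : ℕ) : OccursAt [x] i ↔ fw i = x := by
  simp [OccursAt, seg]

theorem occursAt_cons (x : Bool) (w : List Bool) (i : ℕ) :
    OccursAt (x :: w) i ↔ fw i = x ∧ OccursAt w (i + 1) := by
  rw [← List.singleton_append, occursAt_append, occursAt_singleton, List.length_singleton]

theorem OccursAt.of_prefix {u w : List Bool} {i : ℕ} (h : OccursAt w i) (hu : u <+: w) :
    OccursAt u i := by
  obtain ⟨v, rfl⟩ := hu
  exact ((occursAt_append _ _ _).1 h).1

theorem occursAt_Fw_zero (n : ℕ) : OccursAt (Fw n) 0 := by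
  unfold OccursAt
  refine List.ext_getElem (length_seg _ _) fun i hi hi' => ?_
  have hlen := lt_length_Fw (i + 1)
  have hfw : fw i = (Fw (i + 1))[i]'(by omega) := by
    exact List.getD_eq_getElem _ _ (by omega)
  simp only [seg, List.getElem_map, List.getElem_range, zero_add, hfw]
  rcases le_total n (i + 1) with h | h
  · exact ((Fw_prefix_of_le h).getElem hi').symm
  · exact (Fw_prefix_of_le h).getElem _

theorem OccursAt.prefix_Fw {w : List Bool} (h : OccursAt w 0) : w <+: Fw w.length := by
  have h' : seg 0 (Fw w.length).length = Fw w.length := occursAt_Fw_zero _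
  obtain ⟨d, hd⟩ := Nat.exists_eq_add_of_le (lt_length_Fw w.length).le
  rw [hd, seg_add, show seg 0 w.length = w from h] at h'
  exact ⟨_, h'⟩

theorem OccursAt.fibMorph_zero {w : List Bool} (h : OccursAt w 0) : OccursAt (fibMorph w) 0 := by
  obtain ⟨v, hv⟩ := h.prefix_Fw
  refine (occursAt_Fw_zero (w.length + 1)).of_prefix ⟨fibMorph v, ?_⟩
  rw [← fibMorph_Fw, ← fibMorph_append, hv]

/-- The position in `F_∞` at which the image under `fibMorph` of its `j`-th letter starts. -/
def blockPos : ℕ → ℕ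
  | 0 => 0
  | j + 1 => blockPos j + if fw j then 1 else 2

theorem blockPos_succ_of_false {j : ℕ} (h : fw j = false) :
    blockPos (j + 1) = blockPos j + 2 := by simp [blockPos, h]

theorem blockPos_succ_of_true {j : ℕ} (h : fw j = true) :
    blockPos (j + 1) = blockPos j + 1 := by simp [blockPos, h]

theorem blockPos_strictMono : StrictMono blockPos :=
  strictMono_nat_of_lt_succ fun j => by
    cases h : fw j
    · rw [blockPos_succ_of_false h]; omega
    · rw [blockPos_succ_of_true h]; omega

theorem length_fibMorph_seg (j : ℕ) : (fibMorph (seg 0 j)).length = blockPos j := by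
  induction j with
  | zero => rfl
  | succ j ih =>
    rw [seg_add, fibMorph_append, List.length_append, ih]
    cases h : fw j <;> simp [blockPos, seg, h, fibMorph]

theorem occursAt_fibMorph_letter (j : ℕ) : OccursAt (fibMorph [fw j]) (blockPos j) := by
  have h : OccursAt (seg 0 (j + 1)) 0 := by simp [OccursAt, length_seg]
  have h' := h.fibMorph_zero
  rw [seg_add, fibMorph_append, occursAt_append, length_fibMorph_seg] at h'
  simpa [seg] using h'.2

theorem fw_blockPos (j : ℕ) : fw (blockPos j) = false := by
  have h := occursAt_fibMorph_letter j
  cases hj : fw j <;> rw [hj] at h <;> exact ((occursAt_cons _ _ _).1 h).1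

theorem fw_blockPos_add_one (j : ℕ) : fw (blockPos j + 1) = !fw j := by
  cases hj : fw j
  · have h := occursAt_fibMorph_letter j
    rw [hj] at h
    exact ((occursAt_cons _ _ _).1 ((occursAt_cons _ _ _).1 h).2).1
  · rw [← blockPos_succ_of_true hj]
    exact fw_blockPos _

theorem exists_blockPos (i : ℕ) :
    ∃ j, i = blockPos j ∨ i = blockPos j + 1 ∧ fw j = false := by
  induction i with
  | zero => exact ⟨0, Or.inl rfl⟩
  | succ i ih =>
    obtain ⟨j, rfl | ⟨rfl, hj⟩⟩ := ih
    · cases hj : fw j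
      · exact ⟨j, Or.inr ⟨rfl, hj⟩⟩
      · exact ⟨j + 1, Or.inl (blockPos_succ_of_true hj).symm⟩
    · exact ⟨j + 1, Or.inl (blockPos_succ_of_false hj).symm⟩

theorem exists_eq_blockPos_of_fw_false {i : ℕ} (h : fw i = false) : ∃ j, i = blockPos j := by
  obtain ⟨j, rfl | ⟨rfl, hj⟩⟩ := exists_blockPos i
  · exact ⟨j, rfl⟩
  · simp [fw_blockPos_add_one, hj] at h

theorem exists_eq_blockPos_of_fw_true {i : ℕ} (h : fw i = true) :
    ∃ j, i = blockPos j + 1 ∧ i + 1 = blockPos (j + 1) := by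
  obtain ⟨j, rfl | ⟨rfl, hj⟩⟩ := exists_blockPos i
  · simp [fw_blockPos] at h
  · exact ⟨j, rfl, (blockPos_succ_of_false hj).symm⟩

/-- Desubstitution: `w` occurs at `j` iff `σ(w)a` occurs at the corresponding block. -/
theorem occursAt_fibMorph_append (w : List Bool) (j : ℕ) :
    OccursAt (fibMorph w ++ [false]) (blockPos j) ↔ OccursAt w j := by
  induction w generalizing j with
  | nil => simp [fibMorph, occursAt_singleton, fw_blockPos, occursAt_nil]
  | cons x w ih =>
    cases x
    · simp only [fibMorph, List.cons_append, occursAt_cons, fw_blockPos, fw_blockPos_add_one,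
        Bool.not_eq_true', true_and, add_assoc]
      exact and_congr_right fun h => by rw [← ih, blockPos_succ_of_false h]
    · simp only [fibMorph, List.cons_append, occursAt_cons, fw_blockPos, true_and]
      constructor
      · intro h
        have hj : fw j = true := by
          obtain ⟨v, hv⟩ := exists_fibMorph_append_eq_cons w
          have h' := h
          rw [hv, occursAt_cons, fw_blockPos_add_one] at h'
          simpa using h'.1
        exact ⟨hj, by rwa [← ih, blockPos_succ_of_true hj]⟩
      · rintro ⟨hj, h⟩
        rwa [← ih, blockPos_succ_of_true hj] at h

theorem OccursAt.blockPos_add_length {w : List Bool} {j : ℕ} (h : OccursAt w j) :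
    blockPos (j + w.length) = blockPos j + (fibMorph w).length := by
  induction w generalizing j with
  | nil => rfl
  | cons x w ih =>
    obtain ⟨hx, hw⟩ := (occursAt_cons _ _ _).1 h
    rw [List.length_cons, add_comm w.length 1, ← add_assoc, ih hw]
    cases x
    · rw [blockPos_succ_of_false hx]; simp only [fibMorph, List.length_cons]; omega
    · rw [blockPos_succ_of_true hx]; simp only [fibMorph, List.length_cons]; omega

theorem OccursAt.exists_blockPos_of_fibMorph_append {w : List Bool} {i : ℕ}
    (h : OccursAt (fibMorph w ++ [false]) i) : ∃ j, i = blockPos j ∧ OccursAt w j := by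
  obtain ⟨v, hv⟩ := exists_fibMorph_append_eq_cons w
  have h' := h
  rw [hv, occursAt_cons] at h'
  obtain ⟨j, rfl⟩ := exists_eq_blockPos_of_fw_false h'.1
  exact ⟨j, rfl, (occursAt_fibMorph_append w j).1 h⟩

/-- `F_n` without its last letter. -/
def truncFw (n : ℕ) : List Bool := (Fw n).dropLast

theorem Fw_eq_truncFw_append (n : ℕ) : Fw n = truncFw n ++ [n.bodd] := by
  induction n using Nat.twoStepInduction with
  | zero => rfl
  | one => rfl
  | more n h₀ _ =>
    have h : Fw (n + 2) = Fw (n + 1) ++ truncFw n ++ [n.bodd] := by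
      rw [List.append_assoc, ← h₀]; rfl
    rw [truncFw, h]
    simp

theorem sw_succ (n : ℕ) : sw (n + 1) = (!n.bodd) :: truncFw n := by
  rw [sw, truncFw, Fw_eq_truncFw_append n]
  simp

theorem truncFw_succ_of_even {n : ℕ} (h : n.bodd = false) :
    truncFw (n + 1) = fibMorph (truncFw n) ++ [false] := by
  rw [truncFw, ← fibMorph_Fw, Fw_eq_truncFw_append n, h, fibMorph_append]
  simp [fibMorph]

theorem truncFw_succ_of_odd {n : ℕ} (h : n.bodd = true) :
    truncFw (n + 1) = fibMorph (truncFw n) := by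
  rw [truncFw, ← fibMorph_Fw, Fw_eq_truncFw_append n, h, fibMorph_append]
  simp [fibMorph]

theorem sw_succ_of_odd {n : ℕ} (h : n.bodd = true) :
    sw (n + 1) = fibMorph (sw n) ++ [false] := by
  cases n with
  | zero => simp at h
  | succ n =>
    have h' : n.bodd = false := by simpa using h
    rw [sw_succ, sw_succ, h, h', truncFw_succ_of_even h']
    rfl

theorem cons_sw_succ_of_even {n : ℕ} (h : n.bodd = false) :
    false :: sw (n + 1) = fibMorph (sw n) := by
  cases n with
  | zero => rfl
  | succ n =>
    have h' : n.bodd = true := by simpa using h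
    rw [sw_succ, sw_succ, h, h', truncFw_succ_of_odd h']
    rfl

theorem truncFw_succ (n : ℕ) : truncFw (n + 1) = truncFw n ++ sw n := by
  cases n with
  | zero => rfl
  | succ n =>
    have h : Fw (n + 2) = Fw (n + 1) ++ truncFw n ++ [n.bodd] := by
      rw [List.append_assoc, ← Fw_eq_truncFw_append]; rfl
    rw [truncFw, h, List.dropLast_concat, Fw_eq_truncFw_append (n + 1), sw_succ]
    simp

theorem sw_add_two (n : ℕ) : sw (n + 2) = n.bodd :: (truncFw n ++ sw n) := by
  rw [sw_succ, truncFw_succ]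
  simp

theorem sw_add_three (n : ℕ) : sw (n + 3) = sw (n + 1) ++ sw n ++ sw (n + 1) := by
  rw [sw_add_two, truncFw_succ, sw_succ n]
  simp

theorem reverse_sw (n : ℕ) : (sw n).reverse = sw n := by
  induction n using Nat.strong_induction_on with
  | _ n ih =>
    match n with
    | 0 => rfl
    | 1 => rfl
    | 2 => rfl
    | n + 3 =>
      rw [sw_add_three]
      simp [ih n (by omega), ih (n + 1) (by omega)]

theorem sw_succ_eq_append (n : ℕ) : sw (n + 1) = (truncFw n).reverse ++ [!n.bodd] := by
  rw [← reverse_sw, sw_succ, List.reverse_cons]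

theorem length_lt_length_sw_succ {n : ℕ} (hn : n ≠ 0) : (sw n).length < (sw (n + 1)).length := by
  obtain ⟨n, rfl⟩ := Nat.exists_eq_succ_of_ne_zero hn
  have hpos : 0 < (sw n).length := by
    cases n with
    | zero => simp [sw]
    | succ n => simp [sw_succ]
  rw [sw_succ n, sw_succ (n + 1), truncFw_succ]
  simp only [List.length_cons, List.length_append]
  omega

theorem infix_cons_truncFw_append (n : ℕ) (x : Bool) :
    sw (n + 1) <:+: x :: (truncFw n ++ sw n) ∨ sw (n + 2) <:+: x :: (truncFw n ++ sw n) := by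
  rcases Bool.eq_or_eq_not x n.bodd with rfl | rfl
  · exact Or.inr (by rw [sw_add_two])
  · exact Or.inl (by rw [sw_succ]; exact List.IsPrefix.isInfix ⟨sw n, rfl⟩)

theorem infix_append_reverse_truncFw (n : ℕ) (x : Bool) :
    sw (n + 1) <:+: sw n ++ (truncFw n).reverse ++ [x] ∨
      sw (n + 2) <:+: sw n ++ (truncFw n).reverse ++ [x] := by
  have h : sw n ++ (truncFw n).reverse ++ [x] = (x :: (truncFw n ++ sw n)).reverse := by
    simp [reverse_sw]
  rw [h, ← reverse_sw (n + 1), ← reverse_sw (n + 2), List.reverse_infix, List.reverse_infix]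
  exact infix_cons_truncFw_append n x

theorem OccursAt.exists_fibMorph_of_even {n j : ℕ} (hn : n.bodd = false)
    (h : OccursAt (sw (n + 1)) j) :
    ∃ i, j = i + 1 ∧ OccursAt (fibMorph (sw n) ++ [false]) i := by
  have hfirst : fw j = true := by
    have h' := h
    rw [sw_succ, occursAt_cons, hn] at h'
    simpa using h'.1
  obtain ⟨t, rfl, -⟩ := exists_eq_blockPos_of_fw_true hfirst
  refine ⟨blockPos t, rfl, ?_⟩
  rw [← cons_sw_succ_of_even hn, List.cons_append, occursAt_cons, occursAt_append,
    occursAt_singleton]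
  refine ⟨fw_blockPos t, h, ?_⟩
  have h' := h
  rw [sw_succ_eq_append, occursAt_append, occursAt_singleton, hn] at h'
  obtain ⟨r, -, hr⟩ := exists_eq_blockPos_of_fw_true h'.2
  rw [sw_succ_eq_append, List.length_append, List.length_singleton, ← add_assoc, hr]
  exact fw_blockPos _

/-- Every occurrence of a singular word extends to a fixed context on both sides. -/
theorem OccursAt.sw_context {n j : ℕ} (h : OccursAt (sw n) j) :
    ∃ i, j = i + (truncFw n).length ∧
      OccursAt (truncFw n ++ sw n ++ (truncFw n).reverse) i := by
  induction n generalizing j with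
  | zero => exact ⟨j, rfl, h⟩
  | succ n ih =>
    cases hn : n.bodd
    · obtain ⟨j, rfl, hσ⟩ := h.exists_fibMorph_of_even hn
      obtain ⟨j, rfl, hs⟩ := hσ.exists_blockPos_of_fibMorph_append
      obtain ⟨i, rfl, hc⟩ := ih hs
      have hlen := (hc.of_prefix ⟨_, List.append_assoc _ _ _ |>.symm⟩).blockPos_add_length
      refine ⟨blockPos i, ?_, ?_⟩
      · rw [hlen, truncFw_succ_of_even hn, List.length_append, List.length_singleton, add_assoc]
      · rw [← occursAt_fibMorph_append] at hc
        convert hc using 1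
        rw [truncFw_succ_of_even hn, fibMorph_append, fibMorph_append, ← cons_sw_succ_of_even hn,
          List.reverse_append, List.append_assoc (_ ++ _) _ [false], ← cons_reverse_fibMorph]
        simp
    · rw [sw_succ_of_odd hn] at h
      obtain ⟨j, rfl, hs⟩ := h.exists_blockPos_of_fibMorph_append
      obtain ⟨i, rfl, hc⟩ := ih hs
      have hlen := (hc.of_prefix ⟨_, List.append_assoc _ _ _ |>.symm⟩).blockPos_add_length
      refine ⟨blockPos i, ?_, ?_⟩
      · rw [hlen, truncFw_succ_of_odd hn]
      · rw [← occursAt_fibMorph_append] at hc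
        convert hc using 1
        rw [truncFw_succ_of_odd hn, fibMorph_append, fibMorph_append, sw_succ_of_odd hn,
          List.append_assoc (_ ++ _) _ [false], ← cons_reverse_fibMorph]
        simp

theorem infinite_occursAt_sw (n : ℕ) : {j | OccursAt (sw n) j}.Infinite := by
  induction n with
  | zero =>
    refine (Set.infinite_range_of_injective blockPos_strictMono.injective).mono ?_
    rintro _ ⟨j, rfl⟩
    exact (occursAt_singleton _ _).2 (fw_blockPos j)
  | succ n ih =>
    cases hn : n.bodd
    · refine (ih.image (f := fun j => blockPos j + 1)
        ((add_left_injective 1).comp blockPos_strictMono.injective).injOn).mono ?_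
      rintro _ ⟨j, hj, rfl⟩
      have h := (occursAt_fibMorph_append _ _).2 hj
      rw [← cons_sw_succ_of_even hn, List.cons_append, occursAt_cons] at h
      exact h.2.of_prefix ⟨_, rfl⟩
    · refine (ih.image blockPos_strictMono.injective.injOn).mono ?_
      rintro _ ⟨j, hj, rfl⟩
      have h := (occursAt_fibMorph_append _ _).2 hj
      rwa [← sw_succ_of_odd hn] at h

theorem OccursAt.prefix_of_length_le {u v : List Bool} {i : ℕ} (hu : OccursAt u i)
    (hv : OccursAt v i) (h : u.length ≤ v.length) : u <+: v := by
  obtain ⟨d, hd⟩ := Nat.exists_eq_add_of_le h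
  refine ⟨seg (i + u.length) d, ?_⟩
  rw [← show seg i v.length = v from hv, hd, seg_add, show seg i u.length = u from hu]

theorem OccursAt.suffix_of_length_le {u v : List Bool} {i j : ℕ} (hu : OccursAt u i)
    (hv : OccursAt v j) (hij : i + u.length = j + v.length) (h : u.length ≤ v.length) :
    u <:+ v := by
  obtain ⟨d, hd⟩ := Nat.exists_eq_add_of_le' h
  obtain rfl : i = j + d := by omega
  refine ⟨seg j d, ?_⟩
  rw [← show seg j v.length = v from hv, hd, seg_add, show seg (j + d) u.length = u from hu]

/-- A factor `μ₁ s μ₂` around a singular word `s` containing neither of the next two singular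
words stays inside the forced context of `s`. -/
theorem IsFactor.kernel_context {ω μ₁ μ₂ : List Bool} {n : ℕ} (hfac : IsFactor ω)
    (hdec : ω = μ₁ ++ sw n ++ μ₂) (h₁ : ¬ sw (n + 1) <:+: ω) (h₂ : ¬ sw (n + 2) <:+: ω) :
    μ₁ <:+ truncFw n ∧ μ₂ <+: (truncFw n).reverse := by
  subst hdec
  obtain ⟨i, hi⟩ := hfac
  obtain ⟨hl, hμ₂⟩ := (occursAt_append _ _ _).1 hi
  obtain ⟨hμ₁, hs⟩ := (occursAt_append _ _ _).1 hl
  obtain ⟨j, hj, hctx⟩ := hs.sw_context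
  obtain ⟨hl', hR⟩ := (occursAt_append _ _ _).1 hctx
  obtain ⟨hL, -⟩ := (occursAt_append _ _ _).1 hl'
  rw [List.length_append, ← add_assoc, hj] at hμ₂
  rw [List.length_append, ← add_assoc] at hR
  constructor
  · by_contra hcon
    have hlt : (truncFw n).length < μ₁.length := by
      by_contra hle
      exact hcon (hμ₁.suffix_of_length_le hL hj (not_lt.1 hle))
    obtain ⟨t, rfl⟩ := hL.suffix_of_length_le hμ₁ hj.symm hlt.le
    have ht : t ≠ [] := by rintro rfl; simp at hlt
    have hsub : t.getLast ht :: (truncFw n ++ sw n) <:+: t ++ truncFw n ++ sw n ++ μ₂ := by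
      refine ⟨t.dropLast, μ₂, ?_⟩
      conv_rhs => rw [← List.dropLast_append_getLast ht]
      simp
    exact (infix_cons_truncFw_append n (t.getLast ht)).elim
      (fun h => h₁ (h.trans hsub)) fun h => h₂ (h.trans hsub)
  · by_contra hcon
    have hlt : (truncFw n).reverse.length < μ₂.length := by
      by_contra hle
      exact hcon (hμ₂.prefix_of_length_le hR (not_lt.1 hle))
    obtain ⟨t, rfl⟩ := hR.prefix_of_length_le hμ₂ hlt.le
    cases t with
    | nil => simp at hlt
    | cons x t =>
      have hsub : sw n ++ (truncFw n).reverse ++ [x] <:+: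
          μ₁ ++ sw n ++ ((truncFw n).reverse ++ x :: t) := ⟨μ₁, t, by simp⟩
      exact (infix_append_reverse_truncFw n x).elim
        (fun h => h₁ (h.trans hsub)) fun h => h₂ (h.trans hsub)

theorem IsKernelOf.not_infix_of_length_lt {u v w : List Bool} (h : IsKernelOf u w)
    (hv : IsSingular v) (hlt : u.length < v.length) : ¬ v <:+: w :=
  fun hvw => absurd (h.2.2 v hv hvw) (not_le.2 hlt)

theorem IsKernelOf.decomposition_context {ω μ₁ μ₂ : List Bool} {m : ℕ} (hfac : IsFactor ω)
    (hne : ω ∉ excl) (hker : IsKernelOf (sw m) ω) (hdec : ω = μ₁ ++ sw m ++ μ₂) :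
    μ₁ <:+ truncFw m ∧ μ₂ <+: (truncFw m).reverse := by
  cases m with
  | succ m =>
    have hlt₁ := length_lt_length_sw_succ (Nat.succ_ne_zero m)
    have hlt₂ := length_lt_length_sw_succ (Nat.succ_ne_zero (m + 1))
    exact hfac.kernel_context hdec (hker.not_infix_of_length_lt ⟨_, rfl⟩ hlt₁)
      (hker.not_infix_of_length_lt ⟨_, rfl⟩ (hlt₁.trans hlt₂))
  | zero =>
    have h₂ : ¬ sw 2 <:+: ω := hker.not_infix_of_length_lt ⟨2, rfl⟩ (by decide)
    have h₃ : ¬ sw 3 <:+: ω := hker.not_infix_of_length_lt ⟨3, rfl⟩ (by decide)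
    refine hfac.kernel_context hdec (fun h₁ => ?_) h₂
    obtain ⟨ν₁, ν₂, hν⟩ := h₁
    obtain ⟨hν₁, hν₂⟩ := hfac.kernel_context hν.symm h₂ h₃
    rw [show truncFw 1 = [false] from rfl] at hν₁ hν₂
    rw [List.suffix_cons_iff, List.suffix_nil] at hν₁
    rw [List.reverse_singleton, List.prefix_cons_iff] at hν₂
    have hfalse : false ∈ ω := by simp [hdec, sw]
    have hnu : ν₂ = [] ∨ ν₂ = [false] := by
      rcases hν₂ with h | ⟨t, rfl, ht⟩
      · exact Or.inl h
      · rw [List.prefix_nil] at ht; exact Or.inr (by rw [ht])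
    rcases hν₁ with rfl | rfl <;> rcases hnu with rfl | rfl <;>
      subst hν <;> revert hne hfalse <;> decide

theorem IsKernelOf.occursAt_sw_iff {ω μ₁ μ₂ : List Bool} {m : ℕ} (hfac : IsFactor ω)
    (hne : ω ∉ excl) (hker : IsKernelOf (sw m) ω) (hdec : ω = μ₁ ++ sw m ++ μ₂) (j : ℕ) :
    OccursAt (sw m) j ↔ ∃ i, j = i + μ₁.length ∧ OccursAt ω i := by
  obtain ⟨⟨t, ht⟩, ⟨t', ht'⟩⟩ := hker.decomposition_context hfac hne hdec
  subst hdec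
  constructor
  · intro h
    obtain ⟨i, rfl, hi⟩ := h.sw_context
    refine ⟨i + t.length, by rw [← ht, List.length_append, add_assoc], ?_⟩
    rw [← ht', ← ht] at hi
    have hi' : OccursAt (t ++ ((μ₁ ++ sw m ++ μ₂) ++ t')) i := by simpa using hi
    exact ((occursAt_append _ _ _).1 hi').2.of_prefix ⟨_, rfl⟩
  · rintro ⟨i, rfl, hi⟩
    exact ((occursAt_append _ _ _).1 ((occursAt_append _ _ _).1 hi).1).2

theorem listToFree_append (u v : List Bool) :
    listToFree (u ++ v) = listToFree u * listToFree v := by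
  simp [listToFree]

theorem listToFree_seg (i n : ℕ) :
    listToFree (seg i n) = (listToFree (seg 0 i))⁻¹ * listToFree (seg 0 (i + n)) := by
  rw [seg_add, listToFree_append, zero_add, inv_mul_cancel_left]

theorem OccursAt.listToFree_eq {w : List Bool} {i : ℕ} (h : OccursAt w i) :
    listToFree w = (listToFree (seg 0 i))⁻¹ * listToFree (seg 0 (i + w.length)) := by
  rw [← listToFree_seg, show seg i w.length = w from h]

theorem gap_eq (w : List Bool) (p : ℕ) :
    gap w p = (listToFree (seg 0 (occPos w p + w.length)))⁻¹ *
      listToFree (seg 0 (occPos w (p + 1))) := by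
  unfold gap
  split_ifs with h
  · rw [listToFree_seg, Nat.add_sub_cancel' h]
  · rw [listToFree_seg, Nat.add_sub_cancel' (not_le.1 h).le, mul_inv_rev, inv_inv]

/-- if `ω ∉ {ε,ab,ba,aba}` is a factor of `F_∞` with kernel
decomposition `ω = μ₁ · s_k · μ₂` (here `sw m = s_{m-1}` is the kernel), then for every
`p`: (1) the copy of the kernel inside the `p`-th occurrence `ω_p` is the `p`-th occurrence
of the kernel (so `ω_p = μ₁ · s_{k,p} · μ₂`); (2) in the free group on the alphabet,
`ν_{ω,p} = μ₂⁻¹ · ν_{s_k,p} · μ₁⁻¹`. -/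
theorem stmt8 (ω μ₁ μ₂ : List Bool) (m : ℕ) (hfac : IsFactor ω) (hne : ω ∉ excl)
    (hker : IsKernelOf (sw m) ω) (hdec : ω = μ₁ ++ sw m ++ μ₂) :
    ∀ p : ℕ, occPos (sw m) p = occPos ω p + μ₁.length ∧
      gap ω p = (listToFree μ₂)⁻¹ * gap (sw m) p * (listToFree μ₁)⁻¹ := by
  intro p
  have hiff := hker.occursAt_sw_iff hfac hne hdec
  have hinf := infinite_occursAt_sw m
  have hocc_eq : (fun i => OccursAt (sw m) (i + μ₁.length)) = OccursAt ω := by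
    funext i
    simp [hiff]
  have hpos : ∀ q, occPos (sw m) q = occPos ω q + μ₁.length := fun q => by
    have h := Nat.nth_comp_of_strictMono (p := OccursAt (sw m)) (n := q)
      (f := fun i => i + μ₁.length) (fun _ _ h => Nat.add_lt_add_right h _)
      (fun k hk => by
        obtain ⟨i, rfl, -⟩ := (hiff k).1 hk
        exact ⟨i, rfl⟩)
      (fun hfin => absurd hfin hinf)
    rw [hocc_eq] at h
    exact h.symm
  have hocc : ∀ q, OccursAt ω (occPos ω q) := fun q => by
    have h : OccursAt (sw m) (occPos (sw m) q) := Nat.nth_mem_of_infinite hinf q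
    rw [hpos] at h
    exact (congrFun hocc_eq _).mp h
  refine ⟨hpos p, ?_⟩
  have h₀ := hocc p
  have h₁ := hocc (p + 1)
  have hlen : ω.length = μ₁.length + (sw m).length + μ₂.length := by simp [hdec, add_assoc]
  nth_rw 1 [hdec] at h₀ h₁
  rw [occursAt_append, occursAt_append] at h₀ h₁
  rw [gap_eq, gap_eq, h₀.2.listToFree_eq, h₁.1.1.listToFree_eq, hpos, hpos, hlen,
    List.length_append]
  simp only [← add_assoc]
  group
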